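/- Let N ≥ 1 and let f ∈ ℂ[z₁,…,z_N] be a nonconstant squarefree polynomial. Then there exist a natural number r and a nonzero polynomial g ∈ ℂ[u₁,…,u_N] such that for every u ∈ ℂ^N with g(u) ≠ 0, the set {z ∈ (ℂ*)^N : f(z) = 0 and there exists λ ∈ ℂ with u_i = λ·z_i·(∂f/∂z_i)(z) for every i = 1,…,N} is finite and has exactly r elements. (This is the well-definedness of the maximum likelihood degree of the very affine hypersurface V(f) ∩ (ℂ*)^N: for general coefficients u the 1-form η = Σ_i u_i dz_i/z_i restricted to V(f) degenerates at finitely many points, and this number is constant.) -/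

import Mathlib

open MvPolynomial

/-- A property of points of affine space holds generically if it holds off the zero locus of
some nonzero polynomial. -/
def HoldsGenerically {σ K : Type*} [Field K] (P : (σ → K) → Prop) : Prop :=
  ∃ g : MvPolynomial σ K, g ≠ 0 ∧ ∀ u, eval u g ≠ 0 → P u

namespace HoldsGenerically

variable {σ K : Type*} [Field K] {P Q : (σ → K) → Prop}

theorem of_forall (h : ∀ u, P u) : HoldsGenerically P :=
  ⟨1, one_ne_zero, fun u _ => h u⟩

theorem mono (hP : HoldsGenerically P) (h : ∀ u, P u → Q u) : HoldsGenerically Q := by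
  obtain ⟨g, hg, hgP⟩ := hP
  exact ⟨g, hg, fun u hu => h u (hgP u hu)⟩

theorem and (hP : HoldsGenerically P) (hQ : HoldsGenerically Q) :
    HoldsGenerically fun u => P u ∧ Q u := by
  obtain ⟨g, hg, hgP⟩ := hP
  obtain ⟨h, hh, hhQ⟩ := hQ
  refine ⟨g * h, mul_ne_zero hg hh, fun u hu => ?_⟩
  rw [map_mul] at hu
  exact ⟨hgP u (left_ne_zero_of_mul hu), hhQ u (right_ne_zero_of_mul hu)⟩

theorem forall_of_finite {ι : Type*} [Finite ι] {P : ι → (σ → K) → Prop}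
    (h : ∀ i, HoldsGenerically (P i)) : HoldsGenerically fun u => ∀ i, P i u := by
  cases nonempty_fintype ι
  choose g hg hgP using h
  refine ⟨∏ i, g i, Finset.prod_ne_zero_iff.2 fun i _ => hg i, fun u hu i => hgP i u ?_⟩
  rw [map_prod] at hu
  exact Finset.prod_ne_zero_iff.1 hu i (Finset.mem_univ i)

theorem exists_point [Infinite K] (hP : HoldsGenerically P) : ∃ u, P u := by
  obtain ⟨g, hg, hgP⟩ := hP
  by_contra! h
  exact hg (MvPolynomial.funext fun u => by
    rw [map_zero]
    by_contra hu
    exact h u (hgP u hu))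

end HoldsGenerically

/-- If `h` has as many members as there are variables, then any nonzero polynomial `f` divides
a nontrivial polynomial expression in the members of `h`. -/
theorem MvPolynomial.exists_ne_zero_dvd_aeval {ι K : Type*} [Finite ι] [Field K]
    (h : ι → MvPolynomial ι K) {f : MvPolynomial ι K} (hf : f ≠ 0) :
    ∃ P : MvPolynomial ι K, P ≠ 0 ∧ f ∣ aeval h P := by
  by_cases hind : AlgebraicIndependent K h
  · have hbasis : IsTranscendenceBasis K h :=
      hind.isTranscendenceBasis_of_lift_trdeg_le_of_finite (by
        rw [MvPolynomial.trdeg_of_isDomain]; simp)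
    have halg := hbasis.isAlgebraic
    obtain ⟨⟨r, hr⟩, hr0, hfr⟩ :=
      (halg.isAlgebraic f).exists_nonzero_dvd (mem_nonZeroDivisors_of_ne_zero hf)
    rw [Algebra.adjoin_range_eq_range_aeval] at hr
    obtain ⟨P, rfl⟩ := hr
    refine ⟨P, ?_, hfr⟩
    rintro rfl
    exact hr0 (Subtype.ext (map_zero _))
  · rw [algebraicIndependent_iff] at hind
    push Not at hind
    obtain ⟨P, hP, hP0⟩ := hind
    exact ⟨P, hP0, hP ▸ dvd_zero f⟩

/-- An injective ring homomorphism of finite type out of a Noetherian domain induces a map on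
spectra whose image contains a nonempty basic open set. -/
theorem RingHom.FiniteType.exists_mem_range_comap_of_injective {A B : Type*} [CommRing A]
    [IsDomain A] [IsNoetherianRing A] [CommRing B] {φ : A →+* B} (hφ : φ.FiniteType)
    (hinj : Function.Injective φ) :
    ∃ g : A, g ≠ 0 ∧
      ∀ p : PrimeSpectrum A, g ∉ p.asIdeal → p ∈ Set.range (PrimeSpectrum.comap φ) := by
  obtain ⟨T, hT⟩ := PrimeSpectrum.exists_constructibleSetData_iff.2
    (PrimeSpectrum.isConstructible_range_comap (RingHom.FinitePresentation.of_finiteType.1 hφ))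
  obtain ⟨q, hq, hq0⟩ := Ideal.exists_comap_eq_of_mem_minimalPrimes_of_injective hinj ⊥
    (by rw [IsDomain.minimalPrimes_eq_singleton_bot]; rfl)
  have hbot : (⊥ : PrimeSpectrum A) ∈ T.toSet := by
    rw [hT]
    exact ⟨⟨q, hq⟩, PrimeSpectrum.ext hq0⟩
  simp only [PrimeSpectrum.ConstructibleSetData.toSet, Set.mem_iUnion] at hbot
  obtain ⟨c, hc, hcg, hcf⟩ := hbot
  have hcg0 : ∀ i, c.g i = 0 := fun i => by
    simpa using hcg (Set.mem_range_self i)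
  refine ⟨c.f, fun h0 => hcf (by simp [h0]), fun p hp => ?_⟩
  rw [← hT]
  simp only [PrimeSpectrum.ConstructibleSetData.toSet, Set.mem_iUnion]
  refine ⟨c, hc, ?_, fun h => hp (h (Set.mem_singleton _))⟩
  rintro _ ⟨i, rfl⟩
  rw [hcg0 i]
  exact Ideal.zero_mem _

theorem MvPolynomial.finiteType_mk_comp_C {τ A : Type*} [Finite τ] [CommRing A]
    (I : Ideal (MvPolynomial τ A)) :
    ((Ideal.Quotient.mk I).comp (C : A →+* MvPolynomial τ A)).FiniteType :=
  (RingHom.FiniteType.of_surjective _ Ideal.Quotient.mk_surjective).comp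
    (RingHom.finiteType_algebraMap.2 inferInstance)

/-- The solvability of a system of polynomial equations depending polynomially on parameters
either holds for generic parameters or fails for generic parameters. -/
theorem holdsGenerically_exists_or_not {σ τ K : Type*} [Finite σ] [Finite τ] [Field K]
    [IsAlgClosed K] (S : Set (MvPolynomial τ (MvPolynomial σ K))) :
    HoldsGenerically (fun u : σ → K => ∃ x : τ → K, ∀ p ∈ S, eval x (map (eval u) p) = 0) ∨
    HoldsGenerically
      (fun u : σ → K => ¬ ∃ x : τ → K, ∀ p ∈ S, eval x (map (eval u) p) = 0) := by
  let A := MvPolynomial σ K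
  let I : Ideal (MvPolynomial τ A) := Ideal.span S
  let φ : A →+* MvPolynomial τ A ⧸ I := (Ideal.Quotient.mk I).comp C
  by_cases hinj : Function.Injective φ
  · left
    obtain ⟨g, hg, hgφ⟩ :=
      (MvPolynomial.finiteType_mk_comp_C I).exists_mem_range_comap_of_injective hinj
    refine ⟨g, hg, fun u hu => ?_⟩
    have hprime : (RingHom.ker (eval u : A →+* K)).IsPrime := RingHom.ker_isPrime _
    obtain ⟨Q, hQ⟩ := hgφ ⟨RingHom.ker (eval u : A →+* K), hprime⟩ hu
    have hQ' := congrArg PrimeSpectrum.asIdeal hQ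
    let J : Ideal (MvPolynomial τ A) := Q.asIdeal.comap (Ideal.Quotient.mk I)
    have hJ : J.IsPrime := Ideal.comap_isPrime _ _
    have hker : RingHom.ker (map (σ := τ) (eval u : A →+* K)) ≤ J := by
      rw [MvPolynomial.ker_map, Ideal.map_le_iff_le_comap]
      intro a ha
      exact hQ'.symm.le ha
    have hsurj : Function.Surjective (map (σ := τ) (eval u : A →+* K)) :=
      map_surjective _ fun a => ⟨C a, eval_C a⟩
    have hmap := Ideal.map_isPrime_of_surjective hsurj hker
    obtain ⟨M, hM, hJM⟩ := Ideal.exists_le_maximal _ hmap.ne_top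
    obtain ⟨x, rfl⟩ := isMaximal_iff_eq_vanishingIdeal_singleton.1 hM
    refine ⟨x, fun p hp => ?_⟩
    have hpJ : p ∈ J := by
      change Ideal.Quotient.mk I p ∈ Q.asIdeal
      rw [Ideal.Quotient.eq_zero_iff_mem.2 (Ideal.subset_span hp)]
      exact Ideal.zero_mem _
    have := (mem_vanishingIdeal_singleton_iff x _).1 (hJM (Ideal.mem_map_of_mem _ hpJ))
    rwa [aeval_eq_eval] at this
  · right
    rw [injective_iff_map_eq_zero] at hinj
    push Not at hinj
    obtain ⟨g, hg, hg0⟩ := hinj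
    refine ⟨g, hg0, fun u hu => ?_⟩
    rintro ⟨x, hx⟩
    have hgI : (C g : MvPolynomial τ A) ∈ I := Ideal.Quotient.eq_zero_iff_mem.1 hg
    have hle : I ≤ RingHom.ker ((eval x).comp (map (σ := τ) (eval u : A →+* K))) :=
      Ideal.span_le.2 hx
    have := hle hgI
    rw [RingHom.mem_ker, RingHom.comp_apply, map_C, eval_C] at this
    exact hu this

/-- The points of the torus on `V(f)` that are ML-critical for the data `u`. -/
def mlCriticalPoints {σ K : Type*} [Field K] (f : MvPolynomial σ K) (u : σ → K) :
    Set (σ → K) :=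
  {z | (∀ i, z i ≠ 0) ∧ eval z f = 0 ∧ ∃ lam : K, ∀ i, u i = lam * z i * eval z (pderiv i f)}

/-- On the ML-critical points of generic data, each coordinate takes boundedly many values. -/
theorem exists_holdsGenerically_coordinate_image {σ K : Type*} [Finite σ] [Field K]
    {f : MvPolynomial σ K} (hf : f ≠ 0) (i : σ) :
    ∃ d : ℕ, HoldsGenerically fun u : σ → K =>
      ∃ s : Finset K, s.card ≤ d ∧ ∀ z ∈ mlCriticalPoints f u, z i ∈ s := by
  classical
  let h : Option σ → MvPolynomial (Option σ) K := fun o =>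
    o.elim (X (some i)) fun j => X none * X (some j) * rename some (pderiv j f)
  obtain ⟨P, hP, hfP⟩ := exists_ne_zero_dvd_aeval h
    ((map_ne_zero_iff _ (rename_injective some (Option.some_injective σ))).2 hf)
  let p := optionEquivLeft K σ P
  have hp : p ≠ 0 := (EmbeddingLike.map_ne_zero_iff).2 hP
  refine ⟨p.natDegree, p.leadingCoeff, Polynomial.leadingCoeff_ne_zero.2 hp, fun u hu => ?_⟩
  have hpu : p.map (eval u) ≠ 0 := by
    intro h0
    have := congrArg (Polynomial.coeff · p.natDegree) h0
    rw [Polynomial.coeff_map, Polynomial.coeff_zero] at this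
    exact hu this
  refine ⟨(p.map (eval u)).roots.toFinset, ?_, ?_⟩
  · exact (Multiset.toFinset_card_le _).trans
      ((Polynomial.card_roots' _).trans Polynomial.natDegree_map_le)
  · rintro z ⟨-, hz, lam, hlam⟩
    rw [Multiset.mem_toFinset, Polynomial.mem_roots hpu, Polynomial.IsRoot,
      ← optionEquivLeft_elim_eval]
    have hpoint : (fun o => eval (fun o : Option σ => o.elim lam z) (h o)) =
        fun o => o.elim (z i) u := by
      funext o
      cases o with
      | none => simp [h]
      | some j => simp [h, eval_rename, Function.comp_def, hlam j]
    obtain ⟨q, hq⟩ := hfP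
    have := congrArg (eval fun o : Option σ => o.elim lam z) hq
    rw [map_mul, eval_rename, Function.comp_def] at this
    simp only [Option.elim_some, hz, zero_mul] at this
    rw [← hpoint, ← this, ← aeval_eq_eval, ← aeval_eq_eval]
    simp only [← AlgHom.comp_apply, comp_aeval]

/-- The number of ML-critical points is bounded for generic data. -/
theorem exists_holdsGenerically_card_mlCriticalPoints_le {σ K : Type*} [Finite σ] [Field K]
    {f : MvPolynomial σ K} (hf : f ≠ 0) :
    ∃ d : ℕ, HoldsGenerically fun u : σ → K => (mlCriticalPoints f u).encard ≤ d := by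
  classical
  cases nonempty_fintype σ
  choose d hd using exists_holdsGenerically_coordinate_image hf
  refine ⟨∏ i, d i, (HoldsGenerically.forall_of_finite hd).mono fun u hu => ?_⟩
  choose s hsd hs using hu
  have hsub : mlCriticalPoints f u ⊆ (Fintype.piFinset s : Set (σ → K)) := fun z hz => by
    rw [Finset.mem_coe, Fintype.mem_piFinset]
    exact fun i => hs i z hz
  refine (Set.encard_le_encard hsub).trans ?_
  rw [Set.encard_coe_eq_coe_finsetCard, Fintype.card_piFinset]
  exact_mod_cast Finset.prod_le_prod' fun i _ => hsd i

/-- A set has at least `k` elements iff it contains `k` distinct ones. -/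
theorem Set.natCast_le_encard_iff_exists_injective {α : Type*} {s : Set α} {k : ℕ} :
    (k : ℕ∞) ≤ s.encard ↔ ∃ z : Fin k → α, Function.Injective z ∧ ∀ j, z j ∈ s := by
  constructor
  · intro h
    obtain ⟨t, hts, ht⟩ := Set.exists_subset_encard_eq h
    have htf : t.Finite := Set.finite_of_encard_eq_coe ht
    have : Finite t := htf
    have hcard : Nat.card t = k := by
      rw [Nat.card_coe_set_eq, Set.ncard, ht, ENat.toNat_natCast]
    let e := (Finite.equivFinOfCardEq hcard).symm
    exact ⟨fun j => e j, Subtype.val_injective.comp e.injective, fun j => hts (e j).2⟩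
  · rintro ⟨z, hz, hzs⟩
    calc (k : ℕ∞) = (Set.range z).encard := by
          rw [← Set.image_univ, hz.encard_image, Set.encard_univ]; simp
      _ ≤ s.encard := Set.encard_le_encard (Set.range_subset_iff.2 hzs)

/-- Having at least `k` ML-critical points either holds for generic data or fails for
generic data. -/
theorem holdsGenerically_le_card_mlCriticalPoints_or_not {σ K : Type*} [Finite σ] [Field K]
    [IsAlgClosed K] (f : MvPolynomial σ K) (k : ℕ) :
    HoldsGenerically (fun u : σ → K => (k : ℕ∞) ≤ (mlCriticalPoints f u).encard) ∨
    HoldsGenerically (fun u : σ → K => ¬ (k : ℕ∞) ≤ (mlCriticalPoints f u).encard) := by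
  cases nonempty_fintype σ
  let τ := (Fin k × σ) ⊕ (Fin k × σ) ⊕ Fin k ⊕ (Fin k × Fin k × σ)
  let R := MvPolynomial τ (MvPolynomial σ K)
  let z (j : Fin k) (i : σ) : R := X (.inl (j, i))
  let w (j : Fin k) (i : σ) : R := X (.inr (.inl (j, i)))
  let l (j : Fin k) : R := X (.inr (.inr (.inl j)))
  let y (j j' : Fin k) (i : σ) : R := X (.inr (.inr (.inr (j, j', i))))
  let torus (a : Fin k × σ) : R := w a.1 a.2 * z a.1 a.2 - 1
  let hypersurface (j : Fin k) : R := aeval (z j) f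
  let critical (a : Fin k × σ) : R :=
    C (X a.2) - l a.1 * z a.1 a.2 * aeval (z a.1) (pderiv a.2 f)
  let distinct (a : {a : Fin k × Fin k // a.1 ≠ a.2}) : R :=
    ∑ i, y a.1.1 a.1.2 i * (z a.1.1 i - z a.1.2 i) - 1
  let S : Set R :=
    Set.range torus ∪ Set.range hypersurface ∪ Set.range critical ∪ Set.range distinct
  have heval (u : σ → K) (x : τ → K) (j : Fin k) (p : MvPolynomial σ K) :
      eval x (map (eval u) (aeval (z j) p)) = eval (fun i => x (.inl (j, i))) p := by
    induction p using MvPolynomial.induction_on with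
    | C a =>
      rw [aeval_C, MvPolynomial.algebraMap_apply, MvPolynomial.algebraMap_eq, map_C, eval_C,
        eval_C, eval_C]
    | add p q hp hq => simp only [map_add, hp, hq]
    | mul_X p i hp => simp only [map_mul, hp, aeval_X, z, map_X, eval_X]
  have hS (u : σ → K) : (k : ℕ∞) ≤ (mlCriticalPoints f u).encard ↔
      ∃ x : τ → K, ∀ p ∈ S, eval x (map (eval u) p) = 0 := by
    rw [Set.natCast_le_encard_iff_exists_injective]
    simp only [S, Set.mem_union, or_imp, forall_and, Set.forall_mem_range]
    constructor
    · rintro ⟨a, hinj, ha⟩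
      choose ha0 haf lam hlam using ha
      have hdist : ∀ j j', ∃ b : σ → K, j ≠ j' → ∑ i, b i * (a j i - a j' i) = 1 := by
        classical
        intro j j'
        by_cases hjj : j = j'
        · exact ⟨0, fun h => absurd hjj h⟩
        obtain ⟨i, hi⟩ := Function.ne_iff.1 (hinj.ne hjj)
        refine ⟨Pi.single i (a j i - a j' i)⁻¹, fun _ => ?_⟩
        rw [Finset.sum_eq_single i]
        · rw [Pi.single_eq_same, inv_mul_cancel₀ (sub_ne_zero.2 hi)]
        · intro i' _ hi'
          rw [Pi.single_eq_of_ne hi', zero_mul]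
        · simp
      choose b hb using hdist
      refine ⟨Sum.elim (fun c => a c.1 c.2) (Sum.elim (fun c => (a c.1 c.2)⁻¹)
        (Sum.elim lam fun c => b c.1 c.2.1 c.2.2)), ⟨⟨?_, ?_⟩, ?_⟩, ?_⟩
      · rintro ⟨j, i⟩
        simp [torus, w, z, ha0 j i]
      · intro j
        simp only [hypersurface, heval]
        exact haf j
      · rintro ⟨j, i⟩
        simp only [critical, map_sub, map_mul, heval]
        simp [l, z, hlam j i]
      · rintro ⟨⟨j, j'⟩, hjj⟩
        simp [distinct, y, z, hb j j' hjj]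
    · rintro ⟨x, ⟨⟨htorus, hhyp⟩, hcrit⟩, hdist⟩
      refine ⟨fun j i => x (.inl (j, i)), fun j j' hjj => ?_, fun j => ⟨fun i hi => ?_, ?_,
        x (.inr (.inr (.inl j))), fun i => ?_⟩⟩
      · by_contra hne
        have h := hdist ⟨(j, j'), hne⟩
        have hxx (i : σ) : x (.inl (j, i)) = x (.inl (j', i)) := congrFun hjj i
        simp [distinct, y, z, hxx] at h
      · have h := htorus (j, i)
        simp [torus, w, z, hi] at h
      · rw [← heval u]
        exact hhyp j
      · have h := hcrit (j, i)
        simp only [critical, map_sub, map_mul, heval] at h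
        simpa [l, z, sub_eq_zero] using h
  simp only [hS]
  exact holdsGenerically_exists_or_not S

/-- The number of ML-critical points of a nonzero polynomial is the same for generic data. -/
theorem exists_holdsGenerically_card_mlCriticalPoints_eq {σ K : Type*} [Finite σ] [Field K]
    [IsAlgClosed K] {f : MvPolynomial σ K} (hf : f ≠ 0) :
    ∃ r : ℕ, HoldsGenerically fun u : σ → K => (mlCriticalPoints f u).encard = r := by
  classical
  obtain ⟨d, hd⟩ := exists_holdsGenerically_card_mlCriticalPoints_le hf
  have hex : ∃ k : ℕ, ¬ HoldsGenerically
      fun u : σ → K => (k : ℕ∞) ≤ (mlCriticalPoints f u).encard := by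
    refine ⟨d + 1, fun h => ?_⟩
    have : Infinite K := IsAlgClosed.instInfinite
    obtain ⟨u, hle, hge⟩ := (hd.and h).exists_point
    have := hge.trans hle
    norm_cast at this
    lia
  obtain ⟨r, hr⟩ : ∃ r, Nat.find hex = r + 1 := by
    refine Nat.exists_eq_succ_of_ne_zero fun h0 => Nat.find_spec hex ?_
    rw [h0]
    exact .of_forall fun u => by simp
  have hlow := not_not.1 (Nat.find_min hex (m := r) (by lia))
  have hnot := Nat.find_spec hex
  rw [hr] at hnot
  have hhigh := (holdsGenerically_le_card_mlCriticalPoints_or_not f (r + 1)).resolve_left hnot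
  refine ⟨r, (hlow.and hhigh).mono fun u ⟨h₁, h₂⟩ => le_antisymm ?_ h₁⟩
  rw [not_le, Nat.cast_add, Nat.cast_one] at h₂
  exact Order.le_of_lt_add_one h₂

/-- **Well-definedness of the ML degree of a very affine hypersurface.**
For a nonconstant squarefree polynomial `f` in `N ≥ 1` variables over `ℂ`, there is a
number `r` and a nonzero polynomial `g` in the coefficients `u` such that whenever
`g(u) ≠ 0`, the set of ML-critical points of `f` for `u` in the torus `(ℂ*)^N`
is finite with exactly `r` elements. -/
theorem ml_degree_well_defined (N : ℕ) (hN : 1 ≤ N) (f : MvPolynomial (Fin N) ℂ)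
    (hconst : f.totalDegree ≠ 0) (hsf : Squarefree f) :
    ∃ (r : ℕ) (g : MvPolynomial (Fin N) ℂ), g ≠ 0 ∧
      ∀ u : Fin N → ℂ, eval u g ≠ 0 →
        {z : Fin N → ℂ | (∀ i, z i ≠ 0) ∧ eval z f = 0 ∧
            ∃ lam : ℂ, ∀ i, u i = lam * z i * eval z (pderiv i f)}.Finite ∧
        {z : Fin N → ℂ | (∀ i, z i ≠ 0) ∧ eval z f = 0 ∧
            ∃ lam : ℂ, ∀ i, u i = lam * z i * eval z (pderiv i f)}.ncard = r := by
  have hf : f ≠ 0 := by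
    rintro rfl
    exact hconst totalDegree_zero
  obtain ⟨r, g, hg, hgr⟩ := exists_holdsGenerically_card_mlCriticalPoints_eq hf
  refine ⟨r, g, hg, fun u hu => ?_⟩
  have hcard : (mlCriticalPoints f u).encard = r := hgr u hu
  exact ⟨Set.finite_of_encard_eq_coe hcard, by
    change (mlCriticalPoints f u).ncard = r
    rw [Set.ncard, hcard, ENat.toNat_natCast]⟩
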